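/- The series ∑_{n=0}^∞ ((1/2)_n³ / (n!)³) · (1/4)^n · (1 + 6n) converges to 4/π. -/

import Mathlib

open Real Filter

/-- The Pochhammer symbol (rising factorial) `(a)_n = a (a+1) ⋯ (a+n-1)`. -/
noncomputable def poch (a : ℝ) (n : ℕ) : ℝ := (ascPochhammer ℝ n).eval a

theorem poch_succ (a : ℝ) (n : ℕ) : poch a (n + 1) = poch a n * (a + n) := by
  simp [poch, ascPochhammer_succ_eval]

theorem poch_zero (a : ℝ) : poch a 0 = 1 := by simp [poch]

theorem poch_half_pos (n : ℕ) : 0 < poch (1 / 2) n := by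
  induction n with
  | zero => simp [poch_zero]
  | succ n ih => rw [poch_succ]; positivity

theorem poch_half_le_factorial (n : ℕ) : poch (1 / 2) n ≤ (n.factorial : ℝ) := by
  induction n with
  | zero => simp [poch_zero]
  | succ n ih =>
    rw [poch_succ, Nat.factorial_succ, Nat.cast_mul, mul_comm]
    push_cast
    exact mul_le_mul (by linarith) ih (poch_half_pos n).le (by positivity)

/-- The hypergeometric term underlying the Wilf–Zeilberger pair. -/
noncomputable def wzTerm (n k : ℕ) : ℝ :=
  poch (1 / 2) n ^ 3 * poch (1 / 2) k ^ 2 /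
    ((n.factorial : ℝ) * ((n + k).factorial : ℝ) ^ 2) * (1 / 4) ^ n

theorem wzTerm_nonneg (n k : ℕ) : 0 ≤ wzTerm n k := by
  have h₁ := poch_half_pos n
  unfold wzTerm
  positivity

theorem wzTerm_succ_left (n k : ℕ) :
    wzTerm (n + 1) k =
      wzTerm n k * ((n + 1 / 2 : ℝ) ^ 3 / (4 * (n + 1) * (n + k + 1) ^ 2)) := by
  have h : n + 1 + k = n + k + 1 := by ring
  rw [wzTerm, wzTerm, poch_succ, h, Nat.factorial_succ, Nat.factorial_succ]
  push_cast
  field_simp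
  ring

theorem wzTerm_succ_right (n k : ℕ) :
    wzTerm n (k + 1) = wzTerm n k * ((k + 1 / 2 : ℝ) ^ 2 / (n + k + 1) ^ 2) := by
  have h : n + (k + 1) = n + k + 1 := by ring
  rw [wzTerm, wzTerm, poch_succ, h, Nat.factorial_succ]
  push_cast
  field_simp
  ring

theorem wz_identity (n k : ℕ) :
    wzTerm n (k + 1) * (1 + 4 * ((k + 1 : ℕ) : ℝ) + 6 * n) - wzTerm n k * (1 + 4 * k + 6 * n) =
      8 * ((n + 1 : ℕ) : ℝ) * wzTerm (n + 1) k - 8 * n * wzTerm n k := by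
  rw [wzTerm_succ_left, wzTerm_succ_right]
  push_cast
  field_simp
  ring

theorem sum_wz_succ (N k : ℕ) :
    ∑ n ∈ Finset.range N, wzTerm n (k + 1) * (1 + 4 * ((k + 1 : ℕ) : ℝ) + 6 * n) =
      ∑ n ∈ Finset.range N, wzTerm n k * (1 + 4 * (k : ℝ) + 6 * n) + 8 * N * wzTerm N k := by
  rw [← sub_eq_iff_eq_add', ← Finset.sum_sub_distrib]
  simp_rw [wz_identity]
  rw [Finset.sum_range_sub (fun n => 8 * (n : ℝ) * wzTerm n k)]
  simp

theorem sum_wz_eq (N K : ℕ) :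
    ∑ n ∈ Finset.range N, wzTerm n K * (1 + 4 * (K : ℝ) + 6 * n) =
      ∑ n ∈ Finset.range N, wzTerm n 0 * (1 + 6 * (n : ℝ)) +
        8 * N * ∑ k ∈ Finset.range K, wzTerm N k := by
  induction K with
  | zero => simp
  | succ K ih => rw [sum_wz_succ, ih, Finset.sum_range_succ]; ring

theorem factorial_succ_mul_factorial_succ_le (m k : ℕ) :
    (m + 1).factorial * (k + 1).factorial ≤ (m + 1 + k).factorial := by
  induction m with
  | zero => simp [add_comm]
  | succ m ih =>
    have h : m + 1 + 1 + k = (m + 1 + k) + 1 := by ring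
    rw [h, Nat.factorial_succ (m + 1), Nat.factorial_succ (m + 1 + k), mul_assoc]
    exact Nat.mul_le_mul (by omega) ih

theorem wzTerm_succ_le (m k : ℕ) :
    wzTerm (m + 1) k ≤ (1 / 4) ^ (m + 1) / ((k : ℝ) + 1) ^ 2 := by
  have hm := poch_half_pos (m + 1)
  have hk := poch_half_pos k
  have hm' := poch_half_le_factorial (m + 1)
  have hk' := poch_half_le_factorial k
  have hf : ((m + 1).factorial : ℝ) * (((k : ℝ) + 1) * k.factorial) ≤
      ((m + 1 + k).factorial : ℝ) := by
    exact_mod_cast factorial_succ_mul_factorial_succ_le m k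
  rw [wzTerm, mul_comm, div_eq_mul_one_div (_ ^ (m + 1))]
  refine mul_le_mul_of_nonneg_left ?_ (by positivity)
  rw [div_le_div_iff₀ (by positivity) (by positivity), one_mul]
  calc poch (1 / 2) (m + 1) ^ 3 * poch (1 / 2) k ^ 2 * ((k : ℝ) + 1) ^ 2
      ≤ ((m + 1).factorial : ℝ) ^ 3 * (k.factorial : ℝ) ^ 2 * ((k : ℝ) + 1) ^ 2 := by gcongr
    _ = ((m + 1).factorial : ℝ) *
        (((m + 1).factorial : ℝ) * (((k : ℝ) + 1) * k.factorial)) ^ 2 := by ring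
    _ ≤ _ := by gcongr

theorem wallis_mul_poch_sq (k : ℕ) :
    Real.Wallis.W k * ((2 * k + 1) * poch (1 / 2) k ^ 2) = (k.factorial : ℝ) ^ 2 := by
  induction k with
  | zero => simp [Real.Wallis.W, poch_zero]
  | succ k ih =>
    rw [Real.Wallis.W_succ, poch_succ, Nat.factorial_succ]
    push_cast
    rw [mul_pow, mul_pow _ (k.factorial : ℝ), ← ih]
    field_simp
    ring

theorem tendsto_wzTerm_zero_left :
    Tendsto (fun k : ℕ => wzTerm 0 k * (1 + 4 * (k : ℝ))) atTop (nhds (4 / π)) := by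
  have h : ∀ k : ℕ, wzTerm 0 k * (1 + 4 * (k : ℝ)) =
      (2 - 1 / (2 * (k : ℝ) + 1)) / Real.Wallis.W k := by
    intro k
    have hW := Real.Wallis.W_pos k
    have hp := poch_half_pos k
    rw [wzTerm, zero_add, ← wallis_mul_poch_sq k]
    simp only [poch_zero, Nat.factorial_zero]
    push_cast
    field_simp
    ring
  simp_rw [h]
  have h₁ : Tendsto (fun k : ℕ => 1 / (2 * (k : ℝ) + 1)) atTop (nhds 0) := by
    simp_rw [one_div]
    exact tendsto_inv_atTop_zero.comp (tendsto_atTop_add_const_right _ _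
      (tendsto_natCast_atTop_atTop.const_mul_atTop (by norm_num)))
  have h₂ := (h₁.const_sub 2).div Real.Wallis.tendsto_W_nhds_pi_div_two (by positivity)
  have hlim : (2 - 0) / (π / 2) = 4 / π := by
    field_simp
    norm_num
  rw [← hlim]
  exact h₂

theorem sum_wzTerm_le (N : ℕ) :
    ∑ k ∈ Finset.range (N + 1), wzTerm (N + 1) k ≤ ((N + 1 : ℕ) : ℝ) * (1 / 4) ^ (N + 1) := by
  calc _ ≤ ∑ _k ∈ Finset.range (N + 1), ((1 / 4 : ℝ)) ^ (N + 1) := by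
        refine Finset.sum_le_sum fun k _ => (wzTerm_succ_le N k).trans ?_
        refine div_le_self (by positivity) ?_
        have : (0 : ℝ) ≤ k := k.cast_nonneg
        nlinarith
    _ = _ := by simp

theorem sum_wz_tail_le (N : ℕ) :
    ∑ n ∈ Finset.range N,
        wzTerm (n + 1) (N + 1) * (1 + 4 * ((N + 1 : ℕ) : ℝ) + 6 * ((n + 1 : ℕ) : ℝ)) ≤
      10 * (1 / ((N : ℝ) + 1)) := by
  have hgeom : ∀ M : ℕ, ∑ n ∈ Finset.range M, (1 / 4 : ℝ) ^ (n + 1) ≤ 1 := by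
    intro M
    have : ∑ n ∈ Finset.range M, (1 / 4 : ℝ) ^ (n + 1) = (1 - (1 / 4) ^ M) / 3 := by
      induction M with
      | zero => simp
      | succ M ih => rw [Finset.sum_range_succ, ih]; ring
    rw [this]
    have : (0 : ℝ) ≤ (1 / 4) ^ M := by positivity
    linarith
  calc _ ≤ ∑ n ∈ Finset.range N, (1 / 4 : ℝ) ^ (n + 1) * (10 * (1 / ((N : ℝ) + 1))) := by
        refine Finset.sum_le_sum fun n hn => ?_
        have hn' : (n : ℝ) + 1 ≤ N := by exact_mod_cast Finset.mem_range.mp hn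
        have hN : (0 : ℝ) ≤ N := N.cast_nonneg
        calc _ ≤ (1 / 4) ^ (n + 1) / (((N + 1 : ℕ) : ℝ) + 1) ^ 2 *
              (10 * ((N : ℝ) + 2)) :=
              mul_le_mul (wzTerm_succ_le _ _) (by push_cast; linarith) (by positivity)
                (by positivity)
          _ = (1 / 4) ^ (n + 1) * (10 * (1 / ((N : ℝ) + 2))) := by
              push_cast
              field_simp
              ring
          _ ≤ _ := by gcongr; norm_num
    _ = (∑ n ∈ Finset.range N, (1 / 4 : ℝ) ^ (n + 1)) * (10 * (1 / ((N : ℝ) + 1))) := by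
        rw [Finset.sum_mul]
    _ ≤ 1 * (10 * (1 / ((N : ℝ) + 1))) := by
        gcongr
        exact hgeom N
    _ = _ := one_mul _

theorem stmt13 :
    Tendsto (fun N => ∑ n ∈ Finset.range N,
      (poch (1 / 2) n ^ 3 / (n.factorial : ℝ) ^ 3) * (1 / 4) ^ n * (1 + 6 * (n : ℝ)))
      atTop (nhds (4 / π)) := by
  rw [← tendsto_add_atTop_iff_nat 1]
  have hterm : ∀ n : ℕ, poch (1 / 2) n ^ 3 / (n.factorial : ℝ) ^ 3 * (1 / 4) ^ n = wzTerm n 0 := by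
    intro n
    rw [wzTerm, poch_zero, add_zero]
    ring_nf
  simp_rw [hterm]
  have hboundary : Tendsto (fun N : ℕ => 8 * ((N + 1 : ℕ) : ℝ) *
      ∑ k ∈ Finset.range (N + 1), wzTerm (N + 1) k) atTop (nhds 0) := by
    have hlim : Tendsto (fun N : ℕ => 8 * (((N + 1 : ℕ) : ℝ) ^ 2 * (1 / 4 : ℝ) ^ (N + 1))) atTop
        (nhds 0) := by
      simpa using ((tendsto_add_atTop_iff_nat 1).mpr
        (tendsto_pow_const_mul_const_pow_of_lt_one 2 (r := (1 / 4 : ℝ))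
          (by norm_num) (by norm_num))).const_mul 8
    refine squeeze_zero (fun N => ?_) (fun N => ?_) hlim
    · exact mul_nonneg (by positivity) (Finset.sum_nonneg fun k _ => wzTerm_nonneg _ _)
    · calc _ ≤ 8 * ((N + 1 : ℕ) : ℝ) * (((N + 1 : ℕ) : ℝ) * (1 / 4) ^ (N + 1)) := by
            gcongr
            exact sum_wzTerm_le N
        _ = _ := by ring
  have htail : Tendsto (fun N : ℕ => ∑ n ∈ Finset.range N,
      wzTerm (n + 1) (N + 1) * (1 + 4 * ((N + 1 : ℕ) : ℝ) + 6 * ((n + 1 : ℕ) : ℝ)))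
      atTop (nhds 0) := by
    refine squeeze_zero (fun N => ?_) sum_wz_tail_le ?_
    · exact Finset.sum_nonneg fun n _ => mul_nonneg (wzTerm_nonneg _ _) (by positivity)
    · simpa using (tendsto_one_div_add_atTop_nhds_zero_nat (𝕜 := ℝ)).const_mul 10
  have hhead := (tendsto_add_atTop_iff_nat 1).mpr tendsto_wzTerm_zero_left
  have h := (htail.add hhead).sub hboundary
  rw [zero_add, sub_zero] at h
  refine h.congr fun N => ?_
  rw [sub_eq_iff_eq_add, ← sum_wz_eq, Finset.sum_range_succ']
  simp
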